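/- Fix θ > 0 and an integer ℓ ≥ 1. There exists a constant C''_ℓ (depending only on ℓ and θ) such that for every integer N ≥ 1 and all real numbers x_1, …, x_ℓ in [0,1], if σ is an Ewens(θ)-distributed random permutation of S_N, then |κ( F^{(N)}_σ(x_1), …, F^{(N)}_σ(x_ℓ) )| ≤ C''_ℓ · N^{−ℓ+1}. -/

import Mathlib

open scoped BigOperators Classical
open Finset

noncomputable section

/-- Total number of cycles of a permutation of `Fin N`, fixed points included. -/
def cycleCount {N : ℕ} (σ : Equiv.Perm (Fin N)) : ℕ :=
  Multiset.card σ.cycleType + (N - σ.cycleType.sum)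

/-- Expectation of `f` under the Ewens measure with parameter `θ` on `S_N`. -/
def ewensE (θ : ℝ) (N : ℕ) (f : Equiv.Perm (Fin N) → ℝ) : ℝ :=
  (∑ σ : Equiv.Perm (Fin N), θ ^ cycleCount σ * f σ) / ∏ k ∈ Finset.range N, (θ + (k : ℝ))

/-- Probability of an event under the Ewens measure. -/
def ewensP (θ : ℝ) (N : ℕ) (A : Set (Equiv.Perm (Fin N))) : ℝ :=
  ewensE θ N (fun σ => if σ ∈ A then 1 else 0)

/-- The Bernoulli random variable `B^{(N)}_{i,s}`, equal to 1 iff `σ i = s`. -/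
def Bis {N : ℕ} (i s : Fin N) (σ : Equiv.Perm (Fin N)) : ℝ :=
  if σ i = s then 1 else 0

/-- The set partitions of a finset `S`, encoded as finsets of nonempty disjoint finsets
covering `S`. -/
def partitionsOf {ι : Type*} [DecidableEq ι] (S : Finset ι) : Finset (Finset (Finset ι)) :=
  S.powerset.powerset.filter
    (fun P => (∀ C ∈ P, C.Nonempty) ∧ ∀ j ∈ S, ∃! C, C ∈ P ∧ j ∈ C)

/-- The joint cumulant of the family of random variables indexed by `S`, expressed through
the moments function `M` : `κ = Σ_π (−1)^{#π−1} (#π−1)! Π_{C ∈ π} M C`. -/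
def cumulantOn {ι 𝕜 : Type*} [DecidableEq ι] [Field 𝕜] (S : Finset ι) (M : Finset ι → 𝕜) : 𝕜 :=
  ∑ P ∈ partitionsOf S,
    (-1 : 𝕜) ^ (P.card - 1) * ((P.card - 1).factorial : 𝕜) * ∏ C ∈ P, M C


/-- Number of weak exceedances among the first `k` positions (1-indexed positions
`1,…,k` correspond to `i : Fin N` with `(i:ℕ) < k`). -/
def countExc {N : ℕ} (σ : Equiv.Perm (Fin N)) (k : ℕ) : ℕ :=
  (Finset.univ.filter (fun i : Fin N => (i : ℕ) < k ∧ (i : ℕ) ≤ (σ i : ℕ))).card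

/-- The function `F^{(N)}_σ : [0,1] → ℝ`: equal to `(1/N) Σ_{i=1}^{Nx} B^{ex,N}_i(σ)` when
`Nx` is an integer, and affine on each interval `[i/N,(i+1)/N]`. -/
def Fex {N : ℕ} (σ : Equiv.Perm (Fin N)) (x : ℝ) : ℝ :=
  ((countExc σ ⌊(N : ℝ) * x⌋₊ : ℝ)
    + ((N : ℝ) * x - (⌊(N : ℝ) * x⌋₊ : ℝ)) *
        ((countExc σ (⌊(N : ℝ) * x⌋₊ + 1) : ℝ) - (countExc σ ⌊(N : ℝ) * x⌋₊ : ℝ))) / N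

section Partitions

variable {ι : Type*} [DecidableEq ι]

theorem mem_partitionsOf {S : Finset ι} {P : Finset (Finset ι)} :
    P ∈ partitionsOf S ↔
      (∀ C ∈ P, C ⊆ S) ∧ (∀ C ∈ P, C.Nonempty) ∧ ∀ j ∈ S, ∃! C, C ∈ P ∧ j ∈ C := by
  simp only [partitionsOf, mem_filter, mem_powerset]
  refine and_congr_left fun _ => ⟨fun h C hC => mem_powerset.1 (h hC), fun h C hC =>
    mem_powerset.2 (h C hC)⟩

theorem eq_of_mem_partitionsOf {S : Finset ι} {P : Finset (Finset ι)} (hP : P ∈ partitionsOf S)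
    {C D : Finset ι} (hC : C ∈ P) (hD : D ∈ P) {j : ι} (hjC : j ∈ C) (hjD : j ∈ D) : C = D := by
  obtain ⟨h1, -, h3⟩ := mem_partitionsOf.1 hP
  exact (h3 j (h1 C hC hjC)).unique ⟨hC, hjC⟩ ⟨hD, hjD⟩

theorem singleton_mem_partitionsOf {S : Finset ι} (hS : S.Nonempty) :
    {S} ∈ partitionsOf S := by
  refine mem_partitionsOf.2 ⟨by simp, by simpa using hS, fun j hj => ⟨S, by simpa using hj, ?_⟩⟩
  simp

theorem eq_singleton_of_self_mem {S : Finset ι} {P : Finset (Finset ι)}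
    (hP : P ∈ partitionsOf S) (h : S ∈ P) : P = {S} := by
  obtain ⟨h1, h2, -⟩ := mem_partitionsOf.1 hP
  refine eq_singleton_iff_unique_mem.2 ⟨h, fun C hC => ?_⟩
  obtain ⟨j, hj⟩ := h2 C hC
  exact eq_of_mem_partitionsOf hP hC h hj (h1 C hC hj)

theorem eq_singleton_of_card_eq_one {S : Finset ι} {P : Finset (Finset ι)}
    (hP : P ∈ partitionsOf S) (h : P.card = 1) : P = {S} := by
  obtain ⟨C, rfl⟩ := card_eq_one.1 h
  obtain ⟨h1, h2, h3⟩ := mem_partitionsOf.1 hP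
  congr 1
  refine Subset.antisymm (h1 C (mem_singleton_self C)) fun j hj => ?_
  obtain ⟨D, ⟨hD, hjD⟩, -⟩ := h3 j hj
  rwa [mem_singleton.1 hD] at hjD

theorem insert_sdiff_mem_partitionsOf {S A : Finset ι} {P : Finset (Finset ι)} (hA : A ⊂ S)
    (hP : P ∈ partitionsOf A) : insert (S \ A) P ∈ partitionsOf S ∧ S \ A ∉ P := by
  obtain ⟨h1, h2, h3⟩ := mem_partitionsOf.1 hP
  have hne : (S \ A).Nonempty := sdiff_nonempty.2 hA.2
  refine ⟨mem_partitionsOf.2 ⟨?_, ?_, fun j hj => ?_⟩, fun h => ?_⟩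
  · intro C hC
    rcases mem_insert.1 hC with rfl | hC
    · exact sdiff_subset
    · exact (h1 C hC).trans hA.1
  · intro C hC
    rcases mem_insert.1 hC with rfl | hC
    · exact hne
    · exact h2 C hC
  · by_cases hjA : j ∈ A
    · obtain ⟨C, ⟨hC, hjC⟩, hu⟩ := h3 j hjA
      refine ⟨C, ⟨mem_insert_of_mem hC, hjC⟩, ?_⟩
      rintro D ⟨hD, hjD⟩
      rcases mem_insert.1 hD with rfl | hD
      · exact absurd hjA (mem_sdiff.1 hjD).2
      · exact hu D ⟨hD, hjD⟩
    · refine ⟨S \ A, ⟨mem_insert_self _ _, mem_sdiff.2 ⟨hj, hjA⟩⟩, ?_⟩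
      rintro D ⟨hD, hjD⟩
      rcases mem_insert.1 hD with rfl | hD
      · rfl
      · exact absurd (h1 D hD hjD) hjA
  · obtain ⟨j, hj⟩ := hne
    exact (mem_sdiff.1 hj).2 (h1 _ h hj)

theorem erase_mem_partitionsOf {S C : Finset ι} {Q : Finset (Finset ι)}
    (hQ : Q ∈ partitionsOf S) (hC : C ∈ Q) : Q.erase C ∈ partitionsOf (S \ C) := by
  obtain ⟨h1, h2, h3⟩ := mem_partitionsOf.1 hQ
  refine mem_partitionsOf.2 ⟨fun D hD j hj => ?_, fun D hD => h2 D (mem_of_mem_erase hD),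
    fun j hj => ?_⟩
  · refine mem_sdiff.2 ⟨h1 D (mem_of_mem_erase hD) hj, fun hjC => ?_⟩
    exact ne_of_mem_erase hD (eq_of_mem_partitionsOf hQ (mem_of_mem_erase hD) hC hj hjC)
  · obtain ⟨hjS, hjC⟩ := mem_sdiff.1 hj
    obtain ⟨D, ⟨hD, hjD⟩, hu⟩ := h3 j hjS
    refine ⟨D, ⟨mem_erase.2 ⟨?_, hD⟩, hjD⟩, fun E hE => hu E ⟨mem_of_mem_erase hE.1, hE.2⟩⟩
    rintro rfl
    exact hjC hjD

/-- The moments-cumulants recursion: `M S = ∑ κ(A) M (S \ A)`, the sum being over the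
subsets `A` of `S` that contain a fixed element of `S`. -/
theorem moment_eq_sum_cumulantOn {M : Finset ι → ℝ} (hM : M ∅ = 1) {S : Finset ι} {a : ι}
    (ha : a ∈ S) :
    M S = ∑ A ∈ S.powerset with a ∈ A, cumulantOn A M * M (S \ A) := by
  have hsplit : S.powerset.filter (a ∈ ·) = insert S (S.ssubsets.filter (a ∈ ·)) := by
    ext A
    simp only [mem_filter, mem_powerset, mem_insert, mem_ssubsets]
    constructor
    · rintro ⟨h, h'⟩
      rcases eq_or_ssubset_of_subset h with h | h
      · exact Or.inl h
      · exact Or.inr ⟨h, h'⟩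
    · rintro (rfl | ⟨h, h'⟩)
      · exact ⟨Subset.rfl, ha⟩
      · exact ⟨h.1, h'⟩
  have hproper : ∑ A ∈ S.ssubsets with a ∈ A, cumulantOn A M * M (S \ A) =
      ∑ Q ∈ partitionsOf S, ∑ C ∈ Q with a ∉ C,
        (-1 : ℝ) ^ (Q.card - 2) * ((Q.card - 2).factorial : ℝ) * ∏ C ∈ Q, M C := by
    simp only [cumulantOn, sum_mul]
    rw [sum_sigma', sum_sigma']
    refine sum_bij' (fun x _ => ⟨insert (S \ x.1) x.2, S \ x.1⟩)
      (fun y _ => ⟨S \ y.2, y.1.erase y.2⟩) ?_ ?_ ?_ ?_ ?_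
    · rintro ⟨A, P⟩ h
      simp only [mem_sigma, mem_filter, mem_ssubsets] at h ⊢
      exact ⟨(insert_sdiff_mem_partitionsOf h.1.1 h.2).1, mem_insert_self _ _,
        fun h' => (mem_sdiff.1 h').2 h.1.2⟩
    · rintro ⟨Q, C⟩ h
      simp only [mem_sigma, mem_filter, mem_ssubsets] at h ⊢
      obtain ⟨h1, h2, -⟩ := mem_partitionsOf.1 h.1
      exact ⟨⟨sdiff_ssubset (h1 C h.2.1) (h2 C h.2.1), mem_sdiff.2 ⟨ha, h.2.2⟩⟩,
        erase_mem_partitionsOf h.1 h.2.1⟩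
    · rintro ⟨A, P⟩ h
      simp only [mem_sigma, mem_filter, mem_ssubsets] at h
      simp only [Finset.sdiff_sdiff_eq_self h.1.1.1,
        erase_insert (insert_sdiff_mem_partitionsOf h.1.1 h.2).2]
    · rintro ⟨Q, C⟩ h
      simp only [mem_sigma, mem_filter] at h
      simp only [Finset.sdiff_sdiff_eq_self ((mem_partitionsOf.1 h.1).1 C h.2.1), insert_erase h.2.1]
    · rintro ⟨A, P⟩ h
      simp only [mem_sigma, mem_filter, mem_ssubsets] at h
      have hn := (insert_sdiff_mem_partitionsOf h.1.1 h.2).2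
      simp only [prod_insert hn, card_insert_of_notMem hn]
      rw [show P.card + 1 - 2 = P.card - 1 by omega]
      ring
  rw [hsplit, sum_insert (by simp), hproper, cumulantOn, sdiff_self, bot_eq_empty, hM, mul_one,
    ← sum_add_distrib]
  rw [sum_eq_single_of_mem {S} (singleton_mem_partitionsOf ⟨a, ha⟩)]
  · have : ({S} : Finset (Finset ι)).filter (a ∉ ·) = ∅ := by
      ext C
      simp only [mem_filter, mem_singleton, notMem_empty, iff_false, not_and, not_not]
      rintro rfl
      exact ha
    simp [this]
  · intro Q hQ hne
    obtain ⟨D, ⟨hD, haD⟩, hu⟩ := (mem_partitionsOf.1 hQ).2.2 a ha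
    have hcard : (Q.filter (a ∉ ·)).card = Q.card - 1 := by
      rw [← card_erase_of_mem hD]
      congr 1
      ext C
      simp only [mem_filter, mem_erase]
      constructor
      · rintro ⟨hC, haC⟩
        exact ⟨fun h => haC (h ▸ haD), hC⟩
      · rintro ⟨hCD, hC⟩
        exact ⟨hC, fun haC => hCD (hu C ⟨hC, haC⟩)⟩
    have h0 : Q.card ≠ 0 := card_ne_zero_of_mem hD
    have h1 : Q.card ≠ 1 := fun h => hne (eq_singleton_of_card_eq_one hQ h)
    obtain ⟨m, hm⟩ : ∃ m, Q.card = m + 2 := ⟨Q.card - 2, by omega⟩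
    rw [sum_const, hcard, hm]
    simp only [nsmul_eq_mul, show m + 2 - 1 = m + 1 by omega, show m + 2 - 2 = m by omega,
      Nat.factorial_succ, pow_succ]
    push_cast
    ring

end Partitions

section EwensInsertion

open Equiv.Perm in
/-- Removing a non-fixed point `x` from its cycle by multiplication with `swap x (g x)` turns it
into a fixed point and leaves the other cycles alone. -/
theorem card_cycleType_swap_mul {α : Type*} [Fintype α] [DecidableEq α] (g : Equiv.Perm α) {x : α}
    (hx : g x ≠ x) :
    Multiset.card (Equiv.swap x (g x) * g).cycleType + g.cycleType.sum =
      Multiset.card g.cycleType + (Equiv.swap x (g x) * g).cycleType.sum + 1 := by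
  have hmem : g.cycleOf x ∈ g.cycleFactorsFinset :=
    cycleOf_mem_cycleFactorsFinset_iff.2 (mem_support.2 hx)
  obtain ⟨c, hc⟩ : ∃ c, c = g.cycleOf x := ⟨_, rfl⟩
  rw [← hc] at hmem
  have hd := disjoint_mul_inv_of_mem_cycleFactorsFinset hmem
  have hcyc : c.IsCycle := (mem_cycleFactorsFinset_iff.1 hmem).1
  have hcx : c x = g x := by rw [hc, cycleOf_apply_self]
  have hcx' : c x ≠ x := hcx ▸ hx
  obtain ⟨r, hr⟩ : ∃ r, r = g * c⁻¹ := ⟨_, rfl⟩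
  rw [← hr] at hd
  have hg : g = c * r := by rw [← hd.commute.eq, hr, inv_mul_cancel_right]
  have hs : (Equiv.swap x (c x) * c).support.card + 1 + (if c (c x) = x then 1 else 0) =
        c.support.card ∧
      Multiset.card (Equiv.swap x (c x) * c).cycleType + (if c (c x) = x then 1 else 0) = 1 ∧
      (Equiv.swap x (c x) * c).support ⊆ c.support := by
    split_ifs with h
    · have hcs := hcyc.eq_swap_of_apply_apply_eq_self hcx' h
      have h1 : Equiv.swap x (c x) * c = 1 := by
        nth_rewrite 2 [hcs]
        exact Equiv.swap_mul_self _ _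
      have h2 : c.support.card = 2 := by
        rw [hcs]
        exact card_support_swap hcx'.symm
      simp [h1, h2]
    · have h1 := hcyc.swap_mul hcx' h
      have h2 := support_swap_mul_eq c x h
      refine ⟨?_, by simp [h1.cycleType], by rw [h2]; exact sdiff_subset⟩
      rw [h2, sdiff_singleton_eq_erase, add_zero, card_erase_add_one (mem_support.2 hcx')]
  have hd' : Disjoint (Equiv.swap x (c x) * c) r :=
    hd.symm.mono hs.2.2 subset_rfl
  have hcc : Multiset.card c.cycleType = 1 := by simp [hcyc.cycleType]
  rw [← hcx, hg, ← mul_assoc, hd'.cycleType_mul, hd.symm.cycleType_mul]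
  simp only [Multiset.card_add, Multiset.sum_add, sum_cycleType, hcc]
  omega

theorem sum_cycleType_le {N : ℕ} (σ : Equiv.Perm (Fin N)) : σ.cycleType.sum ≤ N := by
  rw [Equiv.Perm.sum_cycleType]
  simpa using card_le_univ σ.support

theorem cycleType_decomposeFin_symm_zero {N : ℕ} (e : Equiv.Perm (Fin N)) :
    (Equiv.Perm.decomposeFin.symm (0, e)).cycleType = e.cycleType := by
  rw [← Equiv.Perm.cycleType_extendDomain (finSuccAboveEquiv (0 : Fin (N + 1))) (g := e)]
  congr 1
  ext i
  refine Fin.cases ?_ (fun i => ?_) i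
  · rw [Equiv.Perm.decomposeFin_symm_apply_zero,
      Equiv.Perm.extendDomain_apply_not_subtype _ _ (by simp)]
  · have h := Equiv.Perm.extendDomain_apply_image e (finSuccAboveEquiv (0 : Fin (N + 1))) i
    simp only [finSuccAboveEquiv_apply, Fin.succAbove_zero] at h
    rw [h, Equiv.Perm.decomposeFin_symm_apply_succ]
    simp

theorem cycleCount_decomposeFin_symm_zero {N : ℕ} (e : Equiv.Perm (Fin N)) :
    cycleCount (Equiv.Perm.decomposeFin.symm (0, e)) = cycleCount e + 1 := by
  have := sum_cycleType_le e
  simp only [cycleCount, cycleType_decomposeFin_symm_zero]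
  omega

theorem cycleCount_decomposeFin_symm_succ {N : ℕ} (e : Equiv.Perm (Fin N)) (q : Fin N) :
    cycleCount (Equiv.Perm.decomposeFin.symm (q.succ, e)) = cycleCount e := by
  obtain ⟨g, hg⟩ : ∃ g, g = Equiv.Perm.decomposeFin.symm (q.succ, e) := ⟨_, rfl⟩
  have hg0 : g 0 = q.succ := by rw [hg, Equiv.Perm.decomposeFin_symm_apply_zero]
  have hmul : Equiv.swap 0 (g 0) * g = Equiv.Perm.decomposeFin.symm (0, e) := by
    ext i
    rw [hg0, hg, Equiv.Perm.mul_apply]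
    refine Fin.cases ?_ (fun i => ?_) i
    · simp
    · simp [Equiv.Perm.decomposeFin_symm_apply_succ]
  have h := card_cycleType_swap_mul g (x := 0) (by rw [hg0]; exact Fin.succ_ne_zero q)
  rw [hmul, cycleType_decomposeFin_symm_zero] at h
  have h1 := sum_cycleType_le g
  have h2 := sum_cycleType_le e
  rw [← hg]
  simp only [cycleCount]
  omega

/-- The Ewens measure on `S_{N+1}` is obtained from the one on `S_N` by inserting a new smallest
element, either as a fixed point or before the image of some `i`. -/
theorem ewensE_succ {θ : ℝ} (hθ : 0 < θ) (N : ℕ) (f : Equiv.Perm (Fin (N + 1)) → ℝ) :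
    ewensE θ (N + 1) f = ewensE θ N fun e =>
      (θ * f (Equiv.Perm.decomposeFin.symm (0, e)) +
        ∑ i, f (Equiv.Perm.decomposeFin.symm ((e i).succ, e))) / (θ + N) := by
  have hN : θ + (N : ℝ) ≠ 0 := by positivity
  simp only [ewensE, prod_range_succ]
  rw [← Equiv.sum_comp Equiv.Perm.decomposeFin.symm, Fintype.sum_prod_type_right]
  simp only [Fin.sum_univ_succ, cycleCount_decomposeFin_symm_zero,
    cycleCount_decomposeFin_symm_succ]
  rw [mul_comm (∏ k ∈ range N, _), ← div_div, sum_div]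
  congr 1
  refine sum_congr rfl fun e _ => ?_
  rw [← Equiv.sum_comp e (fun q => θ ^ cycleCount e * f (Equiv.Perm.decomposeFin.symm (q.succ, e))),
    ← mul_sum]
  ring

theorem ewensE_add (θ : ℝ) (N : ℕ) (f g : Equiv.Perm (Fin N) → ℝ) :
    ewensE θ N (fun σ => f σ + g σ) = ewensE θ N f + ewensE θ N g := by
  simp [ewensE, mul_add, sum_add_distrib, add_div]

theorem ewensE_const_mul (θ : ℝ) (N : ℕ) (c : ℝ) (f : Equiv.Perm (Fin N) → ℝ) :
    ewensE θ N (fun σ => c * f σ) = c * ewensE θ N f := by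
  simp only [ewensE, mul_left_comm _ c, ← mul_sum, mul_div_assoc]

theorem ewensE_sum {α : Type*} (θ : ℝ) (N : ℕ) (s : Finset α)
    (f : α → Equiv.Perm (Fin N) → ℝ) :
    ewensE θ N (fun σ => ∑ a ∈ s, f a σ) = ∑ a ∈ s, ewensE θ N (f a) := by
  simp only [ewensE, mul_sum]
  rw [sum_comm, sum_div]

theorem ewensE_one {θ : ℝ} (hθ : 0 < θ) (N : ℕ) : ewensE θ N (fun _ => 1) = 1 := by
  induction N with
  | zero => simp [ewensE, cycleCount]
  | succ N ih =>
    have hN : θ + (N : ℝ) ≠ 0 := by positivity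
    rw [ewensE_succ hθ]
    simpa [div_self hN] using ih

end EwensInsertion

section SubsetConvolution

variable {ι : Type*} [DecidableEq ι]

/-- Product of set functions, i.e. of generating functions in square-zero variables. -/
def subsetConv (f g : Finset ι → ℝ) (S : Finset ι) : ℝ :=
  ∑ A ∈ S.powerset, f A * g (S \ A)

theorem subsetConv_comm (f g : Finset ι → ℝ) : subsetConv f g = subsetConv g f := by
  ext S
  refine sum_bij' (fun A _ => S \ A) (fun A _ => S \ A) ?_ ?_ ?_ ?_ ?_
  · simp
  · simp
  · exact fun A hA => Finset.sdiff_sdiff_eq_self (mem_powerset.1 hA)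
  · exact fun A hA => Finset.sdiff_sdiff_eq_self (mem_powerset.1 hA)
  · intro A hA
    rw [Finset.sdiff_sdiff_eq_self (mem_powerset.1 hA), mul_comm]

/-- Choosing `A ⊆ S` and then `B ⊆ A` amounts to choosing `B ⊆ S` and then `A \ B ⊆ S \ B`. -/
theorem sum_powerset_powerset (S : Finset ι) (F : Finset ι → Finset ι → ℝ) :
    ∑ A ∈ S.powerset, ∑ B ∈ A.powerset, F B (A \ B) =
      ∑ B ∈ S.powerset, ∑ C ∈ (S \ B).powerset, F B C := by
  rw [sum_sigma', sum_sigma']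
  refine sum_bij' (fun x _ => ⟨x.2, x.1 \ x.2⟩) (fun y _ => ⟨y.1 ∪ y.2, y.1⟩) ?_ ?_ ?_ ?_ ?_
  · rintro ⟨A, B⟩ h
    simp only [mem_sigma, mem_powerset] at h ⊢
    exact ⟨h.2.trans h.1, sdiff_subset_sdiff h.1 subset_rfl⟩
  · rintro ⟨B, C⟩ h
    simp only [mem_sigma, mem_powerset] at h ⊢
    exact ⟨union_subset h.1 (h.2.trans sdiff_subset), subset_union_left⟩
  · rintro ⟨A, B⟩ h
    simp only [mem_sigma, mem_powerset] at h
    simp only [union_sdiff_of_subset h.2]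
  · rintro ⟨B, C⟩ h
    simp only [mem_sigma, mem_powerset] at h
    have hd : Disjoint B C := (disjoint_sdiff (s := B) (t := S)).mono_right h.2
    simp only [union_sdiff_cancel_left hd]
  · rintro ⟨A, B⟩ h
    rfl

theorem subsetConv_assoc (f g h : Finset ι → ℝ) :
    subsetConv (subsetConv f g) h = subsetConv f (subsetConv g h) := by
  ext S
  simp only [subsetConv, sum_mul, mul_sum]
  rw [← sum_powerset_powerset S fun B C => f B * (g C * h ((S \ B) \ C))]
  refine sum_congr rfl fun A hA => sum_congr rfl fun B hB => ?_
  rw [sdiff_sdiff_left, sup_eq_union, union_sdiff_of_subset (mem_powerset.1 hB), mul_assoc]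

theorem add_subsetConv (f g h : Finset ι → ℝ) :
    subsetConv (f + g) h = subsetConv f h + subsetConv g h := by
  ext S
  simp [subsetConv, add_mul, sum_add_distrib]

/-- The Euler derivation in the variable `a`. -/
def eulerDeriv (a : ι) (f : Finset ι → ℝ) (S : Finset ι) : ℝ :=
  if a ∈ S then f S else 0

theorem eulerDeriv_add (a : ι) (f g : Finset ι → ℝ) :
    eulerDeriv a (f + g) = eulerDeriv a f + eulerDeriv a g := by
  ext S
  by_cases h : a ∈ S <;> simp [eulerDeriv, h]

theorem eulerDeriv_subsetConv (a : ι) (f g : Finset ι → ℝ) :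
    eulerDeriv a (subsetConv f g) =
      subsetConv (eulerDeriv a f) g + subsetConv f (eulerDeriv a g) := by
  ext S
  simp only [eulerDeriv, subsetConv, Pi.add_apply, ← sum_add_distrib, mem_sdiff]
  by_cases h : a ∈ S
  · simp only [h, if_true, true_and]
    refine sum_congr rfl fun A _ => ?_
    by_cases hA : a ∈ A <;> simp [hA]
  · simp only [h, if_false, false_and, mul_zero, add_zero]
    refine (sum_eq_zero fun A hA => ?_).symm
    rw [if_neg fun haA => h (mem_powerset.1 hA haA), zero_mul]

/-- `K` is the logarithm of `M`, expressed through logarithmic derivatives. -/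
structure IsLog (K M : Finset ι → ℝ) : Prop where
  map_empty : M ∅ = 1
  log_empty : K ∅ = 0
  eulerDeriv_eq : ∀ a, eulerDeriv a M = subsetConv (eulerDeriv a K) M

theorem IsLog.mul {K₁ K₂ M₁ M₂ : Finset ι → ℝ} (h₁ : IsLog K₁ M₁) (h₂ : IsLog K₂ M₂) :
    IsLog (K₁ + K₂) (subsetConv M₁ M₂) where
  map_empty := by simp [subsetConv, h₁.map_empty, h₂.map_empty]
  log_empty := by simp [h₁.log_empty, h₂.log_empty]
  eulerDeriv_eq a := by
    rw [eulerDeriv_subsetConv, h₁.eulerDeriv_eq, h₂.eulerDeriv_eq, eulerDeriv_add, add_subsetConv,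
      subsetConv_assoc, subsetConv_comm M₁ (subsetConv _ M₂), subsetConv_assoc,
      subsetConv_comm M₂ M₁]

theorem IsLog.unique {K₁ K₂ M : Finset ι → ℝ} (h₁ : IsLog K₁ M) (h₂ : IsLog K₂ M) : K₁ = K₂ := by
  ext S
  induction S using Finset.strongInduction with
  | H S ih =>
    rcases S.eq_empty_or_nonempty with rfl | ⟨a, ha⟩
    · rw [h₁.log_empty, h₂.log_empty]
    · have h := congrFun ((h₁.eulerDeriv_eq a).symm.trans (h₂.eulerDeriv_eq a)) S
      simp only [subsetConv] at h
      rw [← add_sum_erase _ _ (mem_powerset_self S), ← add_sum_erase (a := S) _ _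
        (mem_powerset_self S)] at h
      have hrest : ∑ A ∈ S.powerset.erase S, eulerDeriv a K₁ A * M (S \ A) =
          ∑ A ∈ S.powerset.erase S, eulerDeriv a K₂ A * M (S \ A) := by
        refine sum_congr rfl fun A hA => ?_
        rw [mem_erase, mem_powerset] at hA
        simp only [eulerDeriv, ih A (ssubset_of_subset_of_ne hA.2 hA.1)]
      rw [hrest, add_left_inj] at h
      simpa [eulerDeriv, ha, h₁.map_empty] using h

theorem isLog_cumulantOn {M : Finset ι → ℝ} (hM : M ∅ = 1) :
    IsLog (fun S => if S = ∅ then 0 else cumulantOn S M) M where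
  map_empty := hM
  log_empty := if_pos rfl
  eulerDeriv_eq a := by
    ext S
    by_cases ha : a ∈ S
    · simp only [eulerDeriv, if_pos ha, subsetConv]
      rw [moment_eq_sum_cumulantOn hM ha, sum_filter]
      refine sum_congr rfl fun A _ => ?_
      by_cases hA : a ∈ A
      · simp [hA, ne_empty_of_mem hA]
      · simp [hA]
    · simp only [eulerDeriv, if_neg ha, subsetConv]
      refine (sum_eq_zero fun A hA => ?_).symm
      rw [if_neg fun haA => ha (mem_powerset.1 hA haA), zero_mul]

theorem IsLog.eq_cumulantOn {K M : Finset ι → ℝ} (h : IsLog K M) {S : Finset ι}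
    (hS : S.Nonempty) : K S = cumulantOn S M := by
  rw [h.unique (isLog_cumulantOn h.map_empty)]
  exact if_neg hS.ne_empty

theorem isLog_prod (v : ι → ℝ) :
    IsLog (fun S => if S.card = 1 then ∏ j ∈ S, v j else 0) (fun S => ∏ j ∈ S, v j) where
  map_empty := prod_empty
  log_empty := by simp
  eulerDeriv_eq a := by
    ext S
    by_cases ha : a ∈ S
    · simp only [eulerDeriv, if_pos ha, subsetConv]
      rw [sum_eq_single_of_mem {a} (by simpa using ha)]
      · simp only [mem_singleton, card_singleton, if_true, prod_singleton, sdiff_singleton_eq_erase]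
        exact (mul_prod_erase S v ha).symm
      · intro A _ hA
        by_cases haA : a ∈ A
        · rw [if_pos haA, if_neg, zero_mul]
          intro h
          obtain ⟨b, rfl⟩ := card_eq_one.1 h
          exact hA (by rw [mem_singleton.1 haA])
        · rw [if_neg haA, zero_mul]
    · simp only [eulerDeriv, if_neg ha, subsetConv]
      refine (sum_eq_zero fun A hA => ?_).symm
      rw [if_neg fun haA => ha (mem_powerset.1 hA haA), zero_mul]

theorem cumulantOn_pow_card_mul (c : ℝ) {M : Finset ι → ℝ} (hM : M ∅ = 1) {S : Finset ι}
    (hS : S.Nonempty) :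
    cumulantOn S (fun A => c ^ A.card * M A) = c ^ S.card * cumulantOn S M := by
  have h := isLog_cumulantOn hM
  have h' : IsLog (fun A => c ^ A.card * if A = ∅ then 0 else cumulantOn A M)
      (fun A => c ^ A.card * M A) := by
    refine ⟨by simp [hM], by simp, fun a => ?_⟩
    ext S
    have key := congrFun (h.eulerDeriv_eq a) S
    have hl : eulerDeriv a (fun A => c ^ A.card * M A) S = c ^ S.card * eulerDeriv a M S := by
      simp [eulerDeriv]
    rw [hl, key]
    simp only [subsetConv, mul_sum]
    refine sum_congr rfl fun A hA => ?_
    rw [← card_sdiff_add_card_eq_card (mem_powerset.1 hA), pow_add]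
    by_cases haA : a ∈ A
    · simp only [eulerDeriv, if_pos haA]
      ring
    · simp only [eulerDeriv, if_neg haA]
      ring
  rw [← h'.eq_cumulantOn hS]
  simp [hS.ne_empty]

/-- The cumulant differs from the top moment by a quantity controlled by the lower moments. -/
theorem exists_abs_cumulantOn_sub_le (S : Finset ι) (b : ℝ) :
    ∃ D : ℝ, ∀ M : Finset ι → ℝ, (∀ C, C ⊂ S → C.Nonempty → |M C| ≤ b) → S.Nonempty →
      |cumulantOn S M - M S| ≤ D := by
  refine ⟨∑ P ∈ (partitionsOf S).erase {S}, ((P.card - 1).factorial : ℝ) * b ^ P.card,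
    fun M hM hS => ?_⟩
  have hmem := singleton_mem_partitionsOf hS
  rw [cumulantOn, ← add_sum_erase _ _ hmem]
  simp only [card_singleton, tsub_self, pow_zero, Nat.factorial_zero, Nat.cast_one, one_mul,
    prod_singleton, add_sub_cancel_left]
  refine (abs_sum_le_sum_abs _ _).trans (sum_le_sum fun P hP => ?_)
  obtain ⟨hPS, hP⟩ := mem_erase.1 hP
  obtain ⟨h1, h2, -⟩ := mem_partitionsOf.1 hP
  rw [abs_mul, abs_mul, abs_pow, abs_neg, abs_one, one_pow, one_mul, Nat.abs_cast, abs_prod]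
  refine mul_le_mul_of_nonneg_left ?_ (Nat.cast_nonneg _)
  rw [← prod_const]
  refine prod_le_prod (fun C _ => abs_nonneg _) fun C hC => hM C ?_ (h2 C hC)
  refine ssubset_of_subset_of_ne (h1 C hC) fun h => hPS (eq_singleton_of_self_mem hP (h ▸ hC))

end SubsetConvolution

section LinearStatistics

/-- Indicator of a weak exceedance of `σ` at `i`. -/
def weakExc {N : ℕ} (σ : Equiv.Perm (Fin N)) (i : Fin N) : ℝ :=
  if i ≤ σ i then 1 else 0

/-- Linear statistic of the weak exceedances with weights `f`. -/
def linStat {N : ℕ} (f : Fin N → ℝ) (σ : Equiv.Perm (Fin N)) : ℝ :=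
  ∑ i, f i * weakExc σ i

theorem weakExc_pow {N : ℕ} (σ : Equiv.Perm (Fin N)) (i : Fin N) {n : ℕ} (hn : n ≠ 0) :
    weakExc σ i ^ n = weakExc σ i := by
  unfold weakExc
  split_ifs <;> simp [hn]

theorem weakExc_decomposeFin_symm_zero {N : ℕ} (p : Fin (N + 1)) (e : Equiv.Perm (Fin N)) :
    weakExc (Equiv.Perm.decomposeFin.symm (p, e)) 0 = 1 := by
  simp [weakExc]

theorem linStat_decomposeFin_symm_zero {N : ℕ} (f : Fin (N + 1) → ℝ) (e : Equiv.Perm (Fin N)) :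
    linStat f (Equiv.Perm.decomposeFin.symm (0, e)) =
      f 0 + linStat (fun i => f i.succ) e := by
  rw [linStat, Fin.sum_univ_succ, weakExc_decomposeFin_symm_zero, mul_one, linStat]
  simp [weakExc, Equiv.Perm.decomposeFin_symm_apply_succ]

theorem linStat_decomposeFin_symm_succ {N : ℕ} (f : Fin (N + 1) → ℝ) (e : Equiv.Perm (Fin N))
    (i : Fin N) :
    linStat f (Equiv.Perm.decomposeFin.symm ((e i).succ, e)) =
      f 0 + (-(f i.succ * weakExc e i) + linStat (fun i => f i.succ) e) := by
  rw [linStat, Fin.sum_univ_succ, weakExc_decomposeFin_symm_zero, mul_one, linStat,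
    ← add_sum_erase _ _ (mem_univ i), ← add_sum_erase (a := i) _ _ (mem_univ i),
    neg_add_cancel_left]
  have h0 : weakExc (Equiv.Perm.decomposeFin.symm ((e i).succ, e)) i.succ = 0 := by
    simp [weakExc, Equiv.Perm.decomposeFin_symm_apply_succ]
  rw [h0, mul_zero, zero_add]
  congr 1
  refine sum_congr rfl fun k hk => ?_
  have hne : (e k).succ ≠ (e i).succ := by
    simpa using ne_of_mem_erase hk
  congr 1
  simp [weakExc, Equiv.Perm.decomposeFin_symm_apply_succ,
    Equiv.swap_apply_of_ne_of_ne (Fin.succ_ne_zero (e k)) hne]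

/-- Joint moments of a family of linear statistics. -/
def jointMoment {ι : Type*} (θ : ℝ) {N : ℕ} (f : ι → Fin N → ℝ) (S : Finset ι) : ℝ :=
  ewensE θ N fun σ => ∏ j ∈ S, linStat (f j) σ

theorem jointMoment_empty {ι : Type*} {θ : ℝ} (hθ : 0 < θ) {N : ℕ} (f : ι → Fin N → ℝ) :
    jointMoment θ f ∅ = 1 := by
  simp [jointMoment, ewensE_one hθ]

variable {ι : Type*} [DecidableEq ι]

/-- Joint cumulant of the statistic with weights `∏ j ∈ A, f j` and of the statistics
with weights `f j` for `j ∈ B`. -/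
def mergedCumulant (θ : ℝ) {N : ℕ} (f : ι → Fin N → ℝ) (A B : Finset ι) : ℝ :=
  if h : A.Nonempty then
    cumulantOn (insert h.choose B)
      (jointMoment θ (Function.update f h.choose fun i => ∏ j ∈ A, f j i))
  else 0

theorem ewensE_linStat_mul {θ : ℝ} (hθ : 0 < θ) {N : ℕ} (f : ι → Fin N → ℝ) {A T : Finset ι}
    (hA : A.Nonempty) (hAT : Disjoint A T) :
    ewensE θ N (fun σ => linStat (fun i => ∏ j ∈ A, f j i) σ * ∏ j ∈ T, linStat (f j) σ) =
      ∑ B ∈ T.powerset, mergedCumulant θ f A B * jointMoment θ f (T \ B) := by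
  obtain ⟨a, ha⟩ : ∃ a, a = hA.choose := ⟨_, rfl⟩
  have haT : a ∉ T := disjoint_left.1 hAT (ha ▸ hA.choose_spec)
  obtain ⟨g, hg⟩ : ∃ g, g = Function.update f a fun i => ∏ j ∈ A, f j i := ⟨_, rfl⟩
  have hga : g a = fun i => ∏ j ∈ A, f j i := by simp [hg]
  have hgj : ∀ j, j ≠ a → g j = f j := fun j hj => by simp [hg, hj]
  have hmom : ∀ U ⊆ T, jointMoment θ g U = jointMoment θ f U := fun U hU => by
    simp only [jointMoment]
    congr 1
    ext σ
    exact prod_congr rfl fun j hj => by rw [hgj j fun h => haT (hU (h ▸ hj))]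
  have hl : ewensE θ N (fun σ => linStat (fun i => ∏ j ∈ A, f j i) σ * ∏ j ∈ T, linStat (f j) σ) =
      jointMoment θ g (insert a T) := by
    simp only [jointMoment]
    congr 1
    ext σ
    rw [prod_insert haT, hga]
    congr 1
    exact prod_congr rfl fun j hj => by rw [hgj j fun h => haT (h ▸ hj)]
  rw [hl, moment_eq_sum_cumulantOn (jointMoment_empty hθ g) (mem_insert_self a T)]
  refine sum_bij' (fun U _ => U.erase a) (fun B _ => insert a B) ?_ ?_ ?_ ?_ ?_
  · intro U hU
    rw [mem_filter, mem_powerset] at hU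
    rw [mem_powerset]
    exact subset_insert_iff.1 hU.1
  · intro B hB
    rw [mem_powerset] at hB
    rw [mem_filter, mem_powerset]
    exact ⟨insert_subset_insert a hB, mem_insert_self a B⟩
  · intro U hU
    exact insert_erase (mem_filter.1 hU).2
  · intro B hB
    exact erase_insert fun h => haT (mem_powerset.1 hB h)
  · intro U hU
    rw [mem_filter, mem_powerset] at hU
    have hsd : insert a T \ U = T \ U.erase a := by
      ext j
      simp only [mem_sdiff, mem_insert, mem_erase]
      by_cases hj : j = a
      · subst hj; simp [hU.2, haT]
      · simp [hj]
    rw [hsd, hmom _ sdiff_subset, mergedCumulant, dif_pos hA]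
    simp only [← ha, ← hg, insert_erase hU.2]

/-- Moments of the perturbation factor between the generating functions of sizes `N` and
`N + 1`. -/
def insertionFactor (θ : ℝ) {N : ℕ} (f : ι → Fin N → ℝ) (S : Finset ι) : ℝ :=
  (if S = ∅ then 1 else 0) +
    (θ + N)⁻¹ * ∑ A ∈ S.powerset, (-1) ^ A.card * mergedCumulant θ f A (S \ A)

theorem insertionFactor_empty (θ : ℝ) {N : ℕ} (f : ι → Fin N → ℝ) :
    insertionFactor θ f ∅ = 1 := by
  simp [insertionFactor, mergedCumulant]

theorem subsetConv_insertionFactor {θ : ℝ} (hθ : 0 < θ) {N : ℕ} (f : ι → Fin N → ℝ)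
    (S : Finset ι) :
    subsetConv (insertionFactor θ f) (jointMoment θ f) S =
      ewensE θ N fun e => (θ * ∏ j ∈ S, linStat (f j) e +
        ∑ i, ∏ j ∈ S, (-(f j i * weakExc e i) + linStat (f j) e)) / (θ + N) := by
  have hN : θ + (N : ℝ) ≠ 0 := by positivity
  have hsum : ∀ e : Equiv.Perm (Fin N),
      ∑ i, ∏ j ∈ S, (-(f j i * weakExc e i) + linStat (f j) e) =
        N * ∏ j ∈ S, linStat (f j) e + ∑ A ∈ S.powerset, (-1) ^ A.card *
          if A = ∅ then 0 else
            (linStat (fun i => ∏ j ∈ A, f j i) e * ∏ j ∈ S \ A, linStat (f j) e) := by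
    intro e
    simp only [prod_add]
    rw [sum_comm, ← add_sum_erase _ _ (empty_mem_powerset S),
      ← add_sum_erase (a := ∅) _ _ (empty_mem_powerset S)]
    simp only [prod_empty, one_mul, sdiff_empty, sum_const, card_univ, Fintype.card_fin,
      nsmul_eq_mul, if_true, mul_zero, zero_add]
    congr 1
    refine sum_congr rfl fun A hA => ?_
    have hA' : A ≠ ∅ := ne_of_mem_erase hA
    rw [if_neg hA', ← sum_mul, ← mul_assoc]
    congr 1
    rw [linStat, mul_sum]
    refine sum_congr rfl fun i _ => ?_
    rw [prod_neg, prod_mul_distrib, prod_const, weakExc_pow _ _ (card_ne_zero.2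
      (nonempty_iff_ne_empty.2 hA'))]
  have hsplit : (fun e => (θ * ∏ j ∈ S, linStat (f j) e +
        ∑ i, ∏ j ∈ S, (-(f j i * weakExc e i) + linStat (f j) e)) / (θ + N)) =
      fun e : Equiv.Perm (Fin N) => ∏ j ∈ S, linStat (f j) e +
        (θ + N)⁻¹ * ∑ A ∈ S.powerset, (-1) ^ A.card *
          if A = ∅ then 0 else
            (linStat (fun i => ∏ j ∈ A, f j i) e * ∏ j ∈ S \ A, linStat (f j) e) := by
    ext e
    rw [hsum e]
    field_simp
    ring
  rw [hsplit, ewensE_add, ewensE_const_mul, ewensE_sum]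
  simp only [ewensE_const_mul]
  simp only [subsetConv, insertionFactor, add_mul, sum_add_distrib]
  congr 1
  · rw [sum_eq_single_of_mem ∅ (empty_mem_powerset S)]
    · simp [jointMoment]
    · intro A _ hA
      simp [hA]
  · simp only [mul_assoc, ← mul_sum, sum_mul]
    congr 1
    have h := sum_powerset_powerset S fun A D =>
      (-1) ^ A.card * (mergedCumulant θ f A D * jointMoment θ f ((S \ A) \ D))
    refine Eq.trans (sum_congr rfl fun C _ => sum_congr rfl fun A hA => ?_) (h.trans ?_)
    · rw [sdiff_sdiff_left, sup_eq_union, union_sdiff_of_subset (mem_powerset.1 hA)]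
    · refine sum_congr rfl fun A _ => ?_
      rw [← mul_sum]
      congr 1
      by_cases hA : A = ∅
      · simp [hA, mergedCumulant, ewensE]
      · simp only [if_neg hA]
        rw [← ewensE_linStat_mul hθ f (nonempty_iff_ne_empty.2 hA) disjoint_sdiff]

theorem jointMoment_succ {θ : ℝ} (hθ : 0 < θ) {N : ℕ} (f : ι → Fin (N + 1) → ℝ) :
    jointMoment θ f = subsetConv (fun S => ∏ j ∈ S, f j 0)
      (subsetConv (insertionFactor θ fun j i => f j i.succ)
        (jointMoment θ fun j i => f j i.succ)) := by
  ext S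
  rw [jointMoment, ewensE_succ hθ]
  simp only [linStat_decomposeFin_symm_zero, linStat_decomposeFin_symm_succ]
  rw [subsetConv]
  simp only [subsetConv_insertionFactor hθ]
  simp only [← ewensE_const_mul]
  rw [← ewensE_sum]
  congr 1
  ext e
  simp only [prod_add (fun j => f j 0)]
  rw [sum_comm, mul_sum, ← sum_add_distrib, sum_div]
  refine sum_congr rfl fun A _ => ?_
  rw [← mul_sum]
  ring

theorem cumulantOn_jointMoment_succ {θ : ℝ} (hθ : 0 < θ) {N : ℕ} (f : ι → Fin (N + 1) → ℝ)
    {S : Finset ι} (hS : S.Nonempty) :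
    cumulantOn S (jointMoment θ f) = (if S.card = 1 then ∏ j ∈ S, f j 0 else 0) +
      (cumulantOn S (insertionFactor θ fun j i => f j i.succ) +
        cumulantOn S (jointMoment θ fun j i => f j i.succ)) := by
  have h := (isLog_prod fun j => f j 0).mul
    ((isLog_cumulantOn (insertionFactor_empty θ fun j i => f j i.succ)).mul
      (isLog_cumulantOn (jointMoment_empty hθ fun j i => f j i.succ)))
  rw [← jointMoment_succ hθ] at h
  rw [← h.eq_cumulantOn hS]
  simp [hS.ne_empty]

end LinearStatistics

section Bounds

theorem abs_inv_mul_sum_le {ι : Type*} {θ B : ℝ} (hθ : 0 < θ) (hB0 : 0 ≤ B) {N : ℕ} {S : Finset ι}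
    {s : Finset (Finset ι)} (hs : s ⊆ S.powerset) {F : Finset ι → ℝ}
    (hF : ∀ A ∈ s, |F A| ≤ B * N) :
    |(θ + N)⁻¹ * ∑ A ∈ s, (-1) ^ A.card * F A| ≤ 2 ^ S.card * B := by
  have hN : 0 < θ + (N : ℝ) := by positivity
  have h1 : |∑ A ∈ s, (-1) ^ A.card * F A| ≤ 2 ^ S.card * (B * N) := by
    refine (abs_sum_le_sum_abs _ _).trans ((sum_le_card_nsmul s _ (B * N) fun A hA => ?_).trans ?_)
    · rw [abs_mul, abs_pow, abs_neg, abs_one, one_pow, one_mul]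
      exact hF A hA
    · rw [nsmul_eq_mul]
      refine mul_le_mul_of_nonneg_right ?_ (by positivity)
      have := card_le_card hs
      rw [card_powerset] at this
      exact_mod_cast this
  rw [abs_mul, abs_of_pos (inv_pos.2 hN), inv_mul_le_iff₀ hN]
  have : 0 ≤ 2 ^ S.card * B * θ := by positivity
  linarith

variable {ι : Type*} [DecidableEq ι]

theorem cumulantOn_jointMoment_zero {θ : ℝ} (hθ : 0 < θ) (f : ι → Fin 0 → ℝ) {S : Finset ι}
    (hS : S.Nonempty) : cumulantOn S (jointMoment θ f) = 0 := by
  have h : IsLog (0 : Finset ι → ℝ) (jointMoment θ f) := by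
    refine ⟨jointMoment_empty hθ f, rfl, fun a => ?_⟩
    ext T
    have hr : subsetConv (eulerDeriv a 0) (jointMoment θ f) T = 0 := by
      simp [subsetConv, eulerDeriv]
    rw [hr, eulerDeriv]
    split_ifs with ha
    · simp [jointMoment, linStat, ewensE, ne_empty_of_mem ha]
    · rfl
  rw [← h.eq_cumulantOn hS, Pi.zero_apply]

/-- A sequence that is multiplied by at most `1` from the index `d` on, by at most `q` before,
and perturbed by at most `K` at each step grows at most linearly. -/
theorem growth_bound {K q : ℝ} (hK : 0 ≤ K) (hq : 1 ≤ q) (d n : ℕ) :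
    q * (K * n * q ^ min n d) + K ≤ K * (n + 1 : ℕ) * q ^ min (n + 1) d ∨
      (d ≤ n ∧ K * n * q ^ min n d + K ≤ K * (n + 1 : ℕ) * q ^ min (n + 1) d) := by
  have h1 : ∀ m : ℕ, K ≤ K * q ^ m := fun m => le_mul_of_one_le_right hK (one_le_pow₀ hq)
  push_cast
  rcases lt_or_ge n d with h | h
  · left
    have := h1 (n + 1)
    rw [min_eq_left h.le, min_eq_left (Nat.succ_le_of_lt h)]
    rw [pow_succ] at *
    linarith
  · right
    have := h1 d
    rw [min_eq_right h, min_eq_right (h.trans (Nat.le_succ n))]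
    exact ⟨h, by linarith⟩

theorem abs_mergedCumulant_le {θ B : ℝ} {N : ℕ} {S : Finset ι}
    (hB : ∀ T ⊂ S, T.Nonempty → ∀ f : ι → Fin N → ℝ, (∀ j i, |f j i| ≤ 1) →
      |cumulantOn T (jointMoment θ f)| ≤ B * N) (hB0 : 0 ≤ B)
    {f : ι → Fin N → ℝ} (hf : ∀ j i, |f j i| ≤ 1) {A D : Finset ι}
    (hAD : ∀ a ∈ A, insert a D ⊂ S) : |mergedCumulant θ f A D| ≤ B * N := by
  rw [mergedCumulant]
  split_ifs with hA
  · refine hB _ (hAD _ hA.choose_spec) (insert_nonempty _ _) _ fun j i => ?_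
    by_cases hj : j = hA.choose
    · rw [hj, Function.update_self, abs_prod]
      exact prod_le_one (fun _ _ => abs_nonneg _) fun k _ => hf k i
    · rw [Function.update_of_ne hj]
      exact hf j i
  · rw [abs_zero]
    positivity

theorem mergedCumulant_singleton (θ : ℝ) {N : ℕ} (f : ι → Fin N → ℝ) {S : Finset ι} {a : ι}
    (ha : a ∈ S) : mergedCumulant θ f {a} (S \ {a}) = cumulantOn S (jointMoment θ f) := by
  have h : ({a} : Finset ι).Nonempty := singleton_nonempty a
  have hc : h.choose = a := mem_singleton.1 h.choose_spec
  rw [mergedCumulant, dif_pos h, hc, sdiff_singleton_eq_erase, insert_erase ha]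
  simp

theorem abs_insertionFactor_le {θ B : ℝ} (hθ : 0 < θ) {N : ℕ} {S : Finset ι}
    (hB : ∀ T ⊂ S, T.Nonempty → ∀ f : ι → Fin N → ℝ, (∀ j i, |f j i| ≤ 1) →
      |cumulantOn T (jointMoment θ f)| ≤ B * N) (hB0 : 0 ≤ B)
    {f : ι → Fin N → ℝ} (hf : ∀ j i, |f j i| ≤ 1) {C : Finset ι} (hC : C ⊂ S)
    (hC0 : C.Nonempty) : |insertionFactor θ f C| ≤ 2 ^ S.card * B := by
  rw [insertionFactor, if_neg hC0.ne_empty, zero_add]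
  refine abs_inv_mul_sum_le hθ hB0 (powerset_mono.2 hC.1) (F := fun A => mergedCumulant θ f A (C \ A))
    fun A hA => abs_mergedCumulant_le hB hB0 hf fun a ha => ?_
  exact Finset.ssubset_of_subset_of_ssubset
    (insert_subset (mem_powerset.1 hA ha) sdiff_subset) hC

theorem abs_insertionFactor_add_le {θ B : ℝ} (hθ : 0 < θ) {N : ℕ} {S : Finset ι}
    (hB : ∀ T ⊂ S, T.Nonempty → ∀ f : ι → Fin N → ℝ, (∀ j i, |f j i| ≤ 1) →
      |cumulantOn T (jointMoment θ f)| ≤ B * N) (hB0 : 0 ≤ B)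
    {f : ι → Fin N → ℝ} (hf : ∀ j i, |f j i| ≤ 1) (hS : S.Nonempty) :
    |insertionFactor θ f S + S.card / (θ + N) * cumulantOn S (jointMoment θ f)| ≤
      2 ^ S.card * B := by
  have hone : ∑ A ∈ S.powerset with A.card = 1, (-1) ^ A.card * mergedCumulant θ f A (S \ A) =
      -(S.card * cumulantOn S (jointMoment θ f)) := by
    rw [← powersetCard_eq_filter, powersetCard_one, sum_map, ← nsmul_eq_mul, ← smul_neg]
    refine sum_eq_card_nsmul fun a ha => ?_
    simp only [Function.Embedding.coeFn_mk, card_singleton, pow_one, neg_one_mul]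
    rw [mergedCumulant_singleton θ f ha]
  have heq : insertionFactor θ f S + S.card / (θ + N) * cumulantOn S (jointMoment θ f) =
      (θ + N)⁻¹ * ∑ A ∈ S.powerset with ¬ A.card = 1,
        (-1) ^ A.card * mergedCumulant θ f A (S \ A) := by
    rw [insertionFactor, if_neg hS.ne_empty, zero_add,
      ← sum_filter_add_sum_filter_not S.powerset (fun A => A.card = 1), hone]
    ring
  rw [heq]
  refine abs_inv_mul_sum_le hθ hB0 (filter_subset _ _) (F := fun A => mergedCumulant θ f A (S \ A))
    fun A hA => abs_mergedCumulant_le hB hB0 hf fun a ha => ?_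
  rw [mem_filter, mem_powerset] at hA
  obtain ⟨b, hb, hba⟩ : ∃ b ∈ A, b ≠ a := by
    by_contra! h
    exact hA.2 (card_eq_one.2 ⟨a, eq_singleton_iff_unique_mem.2 ⟨ha, h⟩⟩)
  refine ssubset_of_subset_of_ne (insert_subset (hA.1 ha) sdiff_subset) fun h => ?_
  have hbS := hA.1 hb
  rw [← h, mem_insert, mem_sdiff] at hbS
  exact hbS.elim hba fun hbA => hbA.2 hb

/-- Joint cumulants of linear statistics of weak exceedances with bounded weights grow at most
linearly in `N`. -/
theorem exists_cumulantOn_jointMoment_le {θ : ℝ} (hθ : 0 < θ) (S : Finset ι) :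
    ∃ C : ℝ, 0 ≤ C ∧ ∀ (N : ℕ), S.Nonempty → ∀ f : ι → Fin N → ℝ, (∀ j i, |f j i| ≤ 1) →
      |cumulantOn S (jointMoment θ f)| ≤ C * N := by
  induction S using Finset.strongInduction with
  | H S ih =>
    choose! C hC0 hC using ih
    obtain ⟨B, hBdef⟩ : ∃ B, B = ∑ T ∈ S.ssubsets, C T := ⟨_, rfl⟩
    have hB0 : 0 ≤ B := hBdef ▸ sum_nonneg fun T hT => hC0 T (mem_ssubsets.1 hT)
    have hB : ∀ N : ℕ, ∀ T ⊂ S, T.Nonempty → ∀ f : ι → Fin N → ℝ, (∀ j i, |f j i| ≤ 1) →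
        |cumulantOn T (jointMoment θ f)| ≤ B * N := by
      intro N T hT hT0 f hf
      refine (hC T hT N hT0 f hf).trans (mul_le_mul_of_nonneg_right ?_ (Nat.cast_nonneg N))
      rw [hBdef]
      exact single_le_sum (fun U hU => hC0 U (mem_ssubsets.1 hU)) (mem_ssubsets.2 hT)
    obtain ⟨D, hD⟩ := exists_abs_cumulantOn_sub_le S (2 ^ S.card * B)
    obtain ⟨K, hK⟩ : ∃ K, K = 1 + |D| + 2 ^ S.card * B := ⟨_, rfl⟩
    have hK0 : 0 ≤ K := by rw [hK]; positivity
    obtain ⟨q, hq⟩ : ∃ q, q = 1 + S.card / θ := ⟨_, rfl⟩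
    have hq1 : 1 ≤ q := by
      rw [hq]
      exact le_add_of_nonneg_right (by positivity)
    have hmain : ∀ N : ℕ, S.Nonempty → ∀ f : ι → Fin N → ℝ, (∀ j i, |f j i| ≤ 1) →
        |cumulantOn S (jointMoment θ f)| ≤ K * N * q ^ min N S.card := by
      intro N hS
      induction N with
      | zero =>
        intro f _
        simp [cumulantOn_jointMoment_zero hθ f hS]
      | succ N ihN =>
        intro f hf
        obtain ⟨g, hg⟩ : ∃ g : ι → Fin N → ℝ, g = fun j i => f j i.succ := ⟨_, rfl⟩
        have hg1 : ∀ j i, |g j i| ≤ 1 := fun j i => by rw [hg]; exact hf j _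
        have hκ := ihN g hg1
        have h1 : |if S.card = 1 then ∏ j ∈ S, f j 0 else 0| ≤ 1 := by
          split_ifs
          · rw [abs_prod]
            exact prod_le_one (fun _ _ => abs_nonneg _) fun j _ => hf j 0
          · simp
        have h2 := hD (insertionFactor θ g)
          (fun T hT hT0 => abs_insertionFactor_le hθ (hB N) hB0 hg1 hT hT0) hS
        have h3 := abs_insertionFactor_add_le hθ (hB N) hB0 hg1 hS
        have hrec := cumulantOn_jointMoment_succ hθ f hS
        rw [← hg] at hrec
        obtain ⟨κ, hκdef⟩ : ∃ κ, κ = cumulantOn S (jointMoment θ g) := ⟨_, rfl⟩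
        rw [← hκdef] at hκ h3 hrec
        have hstep : |cumulantOn S (jointMoment θ f)| ≤
            |1 - S.card / (θ + N)| * |κ| + K := by
          have heq : cumulantOn S (jointMoment θ f) = (1 - S.card / (θ + N)) * κ +
              ((if S.card = 1 then ∏ j ∈ S, f j 0 else 0) +
                (cumulantOn S (insertionFactor θ g) - insertionFactor θ g S) +
                (insertionFactor θ g S + S.card / (θ + N) * κ)) := by
            rw [hrec]
            ring
          rw [heq, ← abs_mul]
          refine (abs_add_le _ _).trans (add_le_add_right ?_ _)
          refine (abs_add_three _ _ _).trans ?_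
          have := le_abs_self D
          linarith
        have hN0 : (0 : ℝ) ≤ N := Nat.cast_nonneg N
        have hratio0 : (0 : ℝ) ≤ S.card / (θ + N) := by positivity
        rcases growth_bound hK0 hq1 S.card N with h | ⟨hle, h⟩
        · refine hstep.trans (le_trans ?_ h)
          have hratio : |1 - (S.card : ℝ) / (θ + N)| ≤ q := by
            have : (S.card : ℝ) / (θ + N) ≤ S.card / θ :=
              div_le_div_of_nonneg_left (by positivity) hθ (by linarith)
            rw [hq, abs_le]
            constructor <;> linarith
          have := mul_le_mul hratio hκ (abs_nonneg κ) (by linarith)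
          linarith
        · refine hstep.trans (le_trans ?_ h)
          have hratio : |1 - (S.card : ℝ) / (θ + N)| ≤ 1 := by
            have hle' : (S.card : ℝ) ≤ N := by exact_mod_cast hle
            have : (S.card : ℝ) / (θ + N) ≤ 1 := (div_le_one (by positivity)).2 (by linarith)
            rw [abs_le]
            constructor <;> linarith
          have := mul_le_mul hratio hκ (abs_nonneg κ) zero_le_one
          linarith
    refine ⟨K * q ^ S.card, by positivity, fun N hS f hf => (hmain N hS f hf).trans ?_⟩
    rw [mul_right_comm]
    exact mul_le_mul_of_nonneg_right
      (mul_le_mul_of_nonneg_left (pow_le_pow_right₀ hq1 (min_le_right _ _)) hK0)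
      (Nat.cast_nonneg N)

/-- Weights expressing `Fex σ x` as a linear statistic. -/
def fexWeight (N : ℕ) (x : ℝ) (i : Fin N) : ℝ :=
  if (i : ℕ) < ⌊(N : ℝ) * x⌋₊ then 1
  else if (i : ℕ) = ⌊(N : ℝ) * x⌋₊ then (N : ℝ) * x - ⌊(N : ℝ) * x⌋₊ else 0

theorem abs_fexWeight_le {N : ℕ} {x : ℝ} (hx : 0 ≤ x) (i : Fin N) : |fexWeight N x i| ≤ 1 := by
  have h0 := Nat.floor_le (mul_nonneg (Nat.cast_nonneg (α := ℝ) N) hx)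
  have h1 := Nat.lt_floor_add_one ((N : ℝ) * x)
  unfold fexWeight
  split_ifs
  · simp
  · rw [abs_le]
    constructor <;> linarith
  · simp

theorem countExc_eq_sum {N : ℕ} (σ : Equiv.Perm (Fin N)) (k : ℕ) :
    (countExc σ k : ℝ) = ∑ i : Fin N, if (i : ℕ) < k then weakExc σ i else 0 := by
  rw [countExc, card_filter, Nat.cast_sum]
  refine sum_congr rfl fun i _ => ?_
  rw [weakExc, ← ite_and, Nat.cast_ite, Nat.cast_one, Nat.cast_zero]
  rfl

theorem Fex_eq_linStat {N : ℕ} (σ : Equiv.Perm (Fin N)) (x : ℝ) :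
    Fex σ x = (N : ℝ)⁻¹ * linStat (fexWeight N x) σ := by
  rw [Fex, countExc_eq_sum, countExc_eq_sum, ← sum_sub_distrib, mul_sum, ← sum_add_distrib,
    linStat, div_eq_inv_mul]
  congr 1
  refine sum_congr rfl fun i _ => ?_
  rw [fexWeight]
  rcases lt_trichotomy (i : ℕ) ⌊(N : ℝ) * x⌋₊ with h | h | h
  · simp [h, h.trans (Nat.lt_succ_self _)]
  · simp [h]
  · simp [h.not_gt, h.ne', Nat.not_lt.2 (Nat.succ_le_of_lt h)]

end Bounds

/-- Proposition 5.3: there is a constant `C''_ℓ` (depending only on `ℓ` and `θ`) such that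
for every `N ≥ 1` and all `x_1,…,x_ℓ ∈ [0,1]`,
`|κ(F^{(N)}_σ(x_1),…,F^{(N)}_σ(x_ℓ))| ≤ C''_ℓ · N^{−ℓ+1}` under the Ewens(θ) measure. -/
theorem cumulant_Fex_bound (θ : ℝ) (hθ : 0 < θ) (ℓ : ℕ) (hℓ : 1 ≤ ℓ) :
    ∃ C : ℝ, ∀ N : ℕ, 1 ≤ N → ∀ x : Fin ℓ → ℝ, (∀ j, x j ∈ Set.Icc (0 : ℝ) 1) →
      |cumulantOn (Finset.univ : Finset (Fin ℓ))
          (fun Δ => ewensE θ N (fun σ => ∏ j ∈ Δ, Fex σ (x j)))|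
        ≤ C * (N : ℝ) ^ (1 - (ℓ : ℤ)) := by
  obtain ⟨C, -, hC⟩ := exists_cumulantOn_jointMoment_le hθ (Finset.univ : Finset (Fin ℓ))
  refine ⟨C, fun N hN x hx => ?_⟩
  have hne : (Finset.univ : Finset (Fin ℓ)).Nonempty := ⟨⟨0, hℓ⟩, mem_univ _⟩
  have hN0 : (N : ℝ) ≠ 0 := by exact_mod_cast Nat.one_le_iff_ne_zero.1 hN
  have h := hC N hne (fun j => fexWeight N (x j)) fun j i => abs_fexWeight_le (hx j).1 i
  have hM : (fun Δ => ewensE θ N (fun σ => ∏ j ∈ Δ, Fex σ (x j))) = fun Δ : Finset (Fin ℓ) =>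
      (N : ℝ)⁻¹ ^ Δ.card * jointMoment θ (fun j => fexWeight N (x j)) Δ := by
    ext Δ
    simp only [Fex_eq_linStat, prod_mul_distrib, prod_const, ewensE_const_mul, jointMoment]
  rw [hM, cumulantOn_pow_card_mul _ (jointMoment_empty hθ _) hne, card_univ, Fintype.card_fin,
    abs_mul, abs_of_nonneg (by positivity : (0 : ℝ) ≤ (N : ℝ)⁻¹ ^ ℓ)]
  refine (mul_le_mul_of_nonneg_left h (by positivity)).trans_eq ?_
  rw [zpow_sub₀ hN0, zpow_one, zpow_natCast, inv_pow]
  ring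

end
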